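/- Let V be a quadratic space of maximal Witt index p ≥ 2 over a field of characteristic ≠ 2, p < k < dim V, and W, W' maximal isotropic subspaces with dim(W ∩ W') = p - 1. If ω ∈ Λ^k V is nonzero and Φ_v(ω) = 0 for every isotropic v ∈ W ∪ W', then ω = α ∧ ω' for some ω' ∈ Λ^{k-p-1} V, where α is a generator of the one-dimensional space Λ^{p+1}(W + W'). -/

import Mathlib

open ExteriorAlgebra

section Preamble

variable {K V : Type} [Field K] [AddCommGroup V] [Module K V]

/-- A subspace is isotropic for the bilinear form `B`. -/
def IsotropicSub (B : LinearMap.BilinForm K V) (W : Submodule K V) : Prop :=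
  ∀ x ∈ W, ∀ y ∈ W, B x y = 0

/-- A subspace is maximal isotropic for `B`. -/
def MaxIsotropic (B : LinearMap.BilinForm K V) (W : Submodule K V) : Prop :=
  IsotropicSub B W ∧ ∀ W' : Submodule K V, IsotropicSub B W' → W ≤ W' → W' = W

/-- `V` has maximal Witt index `⌊dim V / 2⌋`. -/
def MaxWittIndex (B : LinearMap.BilinForm K V) : Prop :=
  ∃ W : Submodule K V, IsotropicSub B W ∧
    Module.finrank K ↥W = Module.finrank K V / 2

/-- The orthogonal complement `v^⊥` of a vector. -/
def perpV (B : LinearMap.BilinForm K V) (v : V) : Submodule K V :=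
  LinearMap.ker (B v)

/-- The line spanned by `v`, viewed inside `v^⊥`. -/
def lineIn (B : LinearMap.BilinForm K V) (v : V) : Submodule K ↥(perpV B v) :=
  Submodule.comap (perpV B v).subtype (Submodule.span K {v})

/-- The quotient `V_v = v^⊥/⟨v⟩`. -/
abbrev Qt (B : LinearMap.BilinForm K V) (v : V) : Type :=
  ↥(perpV B v) ⧸ lineIn B v

/-- The projection `v^⊥ → v^⊥/⟨v⟩`. -/
def projQ (B : LinearMap.BilinForm K V) (v : V) : ↥(perpV B v) →ₗ[K] Qt B v :=
  (lineIn B v).mkQ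

/-- `π : V → V_v` is a linear extension of the canonical projection `v^⊥ → V_v`. -/
def ExtendsProj (B : LinearMap.BilinForm K V) (v : V) (π : V →ₗ[K] Qt B v) : Prop :=
  ∀ x : ↥(perpV B v), π x.val = projQ B v x

/-- The isotropic-Grassmann-cone-preserving map `Φ_v`, defined as contraction by `⟨v,·⟩`
followed by the map induced by (an extension of) the projection `v^⊥ → v^⊥/⟨v⟩`.
Its restriction to `⋀^k V` does not depend on the chosen extension `π`. -/
noncomputable def Phi (B : LinearMap.BilinForm K V) (v : V) (π : V →ₗ[K] Qt B v) :
    ExteriorAlgebra K V →ₗ[K] ExteriorAlgebra K (Qt B v) :=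
  (ExteriorAlgebra.map π).toLinearMap ∘ₗ
    (CliffordAlgebra.contractLeft (Q := (0 : QuadraticForm K V)) (B v))

/-- The span of the decomposable `m`-vectors with factors in `W`, i.e. `⋀^m W` viewed
inside `⋀^m V`. -/
def epowSub (K : Type) [Field K] {V : Type} [AddCommGroup V] [Module K V]
    (W : Submodule K V) (m : ℕ) : Submodule K (ExteriorAlgebra K V) :=
  Submodule.span K {x | ∃ w : Fin m → V, (∀ i, w i ∈ W) ∧ x = ExteriorAlgebra.ιMulti K m w}

end Preamble

section Helpers

variable {K V : Type} [Field K] [AddCommGroup V] [Module K V]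

noncomputable def ctr (φ : V →ₗ[K] K) : ExteriorAlgebra K V →ₗ[K] ExteriorAlgebra K V :=
  CliffordAlgebra.contractLeft (Q := (0 : QuadraticForm K V)) φ

lemma ctr_mul (φ : V →ₗ[K] K) (x : V) (η : ExteriorAlgebra K V) :
    ctr φ (ι K x * η) = φ x • η - ι K x * ctr φ η :=
  CliffordAlgebra.contractLeft_ι_mul _ _ _

lemma ctr_self (φ : V →ₗ[K] K) (η : ExteriorAlgebra K V) : ctr φ (ctr φ η) = 0 :=
  CliffordAlgebra.contractLeft_contractLeft _ _

lemma ctr_comm (φ ψ : V →ₗ[K] K) (η : ExteriorAlgebra K V) :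
    ctr φ (ctr ψ η) = - ctr ψ (ctr φ η) :=
  CliffordAlgebra.contractLeft_comm _ _ _

lemma ctr_algebraMap (φ : V →ₗ[K] K) (r : K) : ctr φ (algebraMap K _ r) = 0 :=
  CliffordAlgebra.contractLeft_algebraMap _ _ _

lemma ctr_add_left (φ ψ : V →ₗ[K] K) (η : ExteriorAlgebra K V) :
    ctr (φ + ψ) η = ctr φ η + ctr ψ η := by
  simp [ctr]

lemma ctr_smul_left (c : K) (φ : V →ₗ[K] K) (η : ExteriorAlgebra K V) :
    ctr (c • φ) η = c • ctr φ η := by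
  simp [ctr]

lemma ea_ind {P : ExteriorAlgebra K V → Prop} (h0 : ∀ r : K, P (algebraMap _ _ r))
    (ha : ∀ x y, P x → P y → P (x + y)) (hm : ∀ x m, P x → P (ι K m * x)) (x) : P x :=
  CliffordAlgebra.left_induction (Q := (0 : QuadraticForm K V)) h0 ha hm x

lemma sq0 (x : V) (η : ExteriorAlgebra K V) : ι K x * (ι K x * η) = 0 := by
  rw [← mul_assoc, ι_sq_zero, zero_mul]

lemma anti (x y : V) (η : ExteriorAlgebra K V) :
    ι K x * (ι K y * η) = - (ι K y * (ι K x * η)) := by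
  have := sq0 (x + y) η
  simp only [map_add, add_mul, mul_add, sq0, zero_add, add_zero] at this
  rw [eq_neg_iff_add_eq_zero]
  rw [add_comm]; exact this

lemma map_shear (φ : V →ₗ[K] K) (y : V) (P : V →ₗ[K] V) (hP : ∀ x, P x = x - φ x • y)
    (η : ExteriorAlgebra K V) : ExteriorAlgebra.map P η = η - ι K y * ctr φ η := by
  induction η using ea_ind with
  | h0 r => simp [ctr_algebraMap]
  | ha a b iha ihb => simp only [map_add, iha, ihb, mul_add]; abel
  | hm a m ih =>
    rw [map_mul, map_apply_ι, ih, hP, ctr_mul]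
    simp only [map_sub, map_smul, sub_mul, mul_sub, smul_mul_assoc, mul_smul_comm, sq0, smul_zero,
      sub_zero]
    rw [anti m y]; abel

lemma map_mod (v : V) (g h : V →ₗ[K] V) (hgh : ∀ x, ∃ c : K, g x = h x + c • v)
    (η : ExteriorAlgebra K V) :
    ι K v * ExteriorAlgebra.map g η = ι K v * ExteriorAlgebra.map h η := by
  induction η using ea_ind with
  | h0 r => simp
  | ha a b iha ihb => simp only [map_add, iha, ihb, mul_add]
  | hm a m ih =>
    obtain ⟨c, hc⟩ := hgh m
    rw [map_mul, map_mul, map_apply_ι, map_apply_ι, anti, ih, ← anti, hc]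
    simp [add_mul, mul_add, sq0]

lemma ctr_mem (φ : V →ₗ[K] K) (k : ℕ) : ∀ η ∈ ⋀[K]^(k+1) V, ctr φ η ∈ ⋀[K]^k V := by
  induction k with
  | zero =>
    intro η hη
    rw [exteriorPower, zero_add, pow_one] at hη
    obtain ⟨x, rfl⟩ := hη
    have := ctr_mul φ x 1
    rw [mul_one, ← map_one (algebraMap K (ExteriorAlgebra K V)), ctr_algebraMap, mul_zero, sub_zero] at this
    rw [this]
    apply Submodule.smul_mem
    rw [exteriorPower, pow_zero, map_one]
    exact Submodule.one_le.mp le_rfl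
  | succ k ih =>
    intro η hη
    rw [exteriorPower, pow_succ'] at hη
    induction hη using Submodule.mul_induction_on' with
    | mem_mul_mem m hm n hn =>
      obtain ⟨x, rfl⟩ := hm
      rw [ctr_mul]
      refine sub_mem (Submodule.smul_mem _ _ hn) ?_
      rw [exteriorPower, pow_succ']
      exact Submodule.mul_mem_mul ⟨x, rfl⟩ (ih _ hn)
    | add x _ y _ hx hy => rw [map_add]; exact add_mem hx hy

lemma top_zero [FiniteDimensional K V] (k : ℕ) (hk : Module.finrank K V < k)
    (η : ExteriorAlgebra K V) (hη : η ∈ ⋀[K]^k V) : η = 0 := by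
  have h1 : Module.finrank K (⋀[K]^k V) = 0 := by
    rw [exteriorPower.finrank_eq, Nat.choose_eq_zero_of_lt hk]
  have h2 := Module.finrank_zero_iff.mp h1
  have := Subsingleton.elim (⟨η, hη⟩ : ⋀[K]^k V) 0
  simpa using congrArg Subtype.val this

/-- divisibility -/
lemma divide (m : ℕ) : ∀ (x : Fin m → V) (φ : Fin m → (V →ₗ[K] K))
    (_ : ∀ i j, φ i (x j) = if i = j then 1 else 0) (k : ℕ) (ω : ExteriorAlgebra K V)
    (_ : ω ∈ ⋀[K]^(k+m) V) (_ : ∀ i, ι K (x i) * ω = 0),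
    ∃ ω' ∈ ⋀[K]^k V, ω = ιMulti K m x * ω' := by
  induction m with
  | zero => intro x φ _ k ω hω _; exact ⟨ω, hω, by simp⟩
  | succ m ih =>
    intro x φ hφ k ω hω hx
    have key : ω = ι K (x 0) * ctr (φ 0) ω := by
      have := ctr_mul (φ 0) (x 0) ω
      rw [hx, map_zero, hφ] at this
      rw [if_pos rfl, one_smul] at this
      exact sub_eq_zero.mp this.symm
    obtain ⟨ω', h1, h2⟩ := ih (Matrix.vecTail x) (Matrix.vecTail φ)
      (by intro i j; simp [Matrix.vecTail, hφ, Fin.succ_inj]) k (ctr (φ 0) ω)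
      (ctr_mem _ _ _ hω) (by
        intro i
        have := ctr_mul (φ 0) (x i.succ) ω
        rw [hx, map_zero, hφ, if_neg (Fin.succ_ne_zero i).symm, zero_smul, zero_sub] at this
        exact neg_eq_zero.mp this.symm)
    exact ⟨ω', h1, by rw [ιMulti_succ_apply, mul_assoc, ← h2]; exact key⟩

/-- vanishing -/
lemma vanish_aux (m : ℕ) : ∀ (f : Fin m → V) (φ : Fin m → (V →ₗ[K] K))
    (_ : ∀ i j, φ i (f j) = if i = j then 1 else 0) (ω : ExteriorAlgebra K V)
    (_ : ∀ i, ctr (φ i) ω = 0) (_ : ιMulti K m f * ω = 0), ω = 0 := by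
  have cm : ∀ (m : ℕ) (f : Fin m → V) (ψ : V →ₗ[K] K) (_ : ∀ j, ψ (f j) = 0)
      (ω : ExteriorAlgebra K V) (_ : ctr ψ ω = 0), ctr ψ (ιMulti K m f * ω) = 0 := by
    intro m
    induction m with
    | zero => intro f ψ _ ω h; simpa using h
    | succ m ih =>
      intro f ψ hf ω h
      rw [ιMulti_succ_apply, mul_assoc, ctr_mul, hf, ih (Matrix.vecTail f) ψ (fun j => hf _) ω h]
      simp
  induction m with
  | zero => intro f φ _ ω _ h; simpa using h
  | succ m ih =>
    intro f φ hφ ω hc h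
    refine ih (Matrix.vecTail f) (Matrix.vecTail φ)
      (by intro i j; simp [Matrix.vecTail, hφ, Fin.succ_inj]) ω (fun i => hc _) ?_
    have := ctr_mul (φ 0) (f 0) (ιMulti K m (Matrix.vecTail f) * ω)
    rw [cm m _ (φ 0) (by intro j; simp [Matrix.vecTail, hφ, (Fin.succ_ne_zero j).symm]) ω (hc 0),
      ← mul_assoc, ← ιMulti_succ_apply, h, map_zero, hφ] at this
    simpa [eq_comm] using this

lemma vanish [FiniteDimensional K V] (m k : ℕ) (f : Fin m → V) (φ : Fin m → (V →ₗ[K] K))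
    (hφ : ∀ i j, φ i (f j) = if i = j then 1 else 0) (ω : ExteriorAlgebra K V)
    (hω : ω ∈ ⋀[K]^k V) (hk : Module.finrank K V < m + k)
    (hc : ∀ i, ctr (φ i) ω = 0) : ω = 0 := by
  refine vanish_aux m f φ hφ ω hc (top_zero (m + k) hk _ ?_)
  rw [exteriorPower, pow_add]
  exact Submodule.mul_mem_mul (ιMulti_range K m ⟨f, rfl⟩) hω

lemma phi_zero (B : LinearMap.BilinForm K V) (hB : B.Nondegenerate)
    (v : V) (hv : v ≠ 0) (hvv : B v v = 0) (ω : ExteriorAlgebra K V)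
    (h : ∀ π : V →ₗ[K] Qt B v, ExtendsProj B v π → Phi B v π ω = 0) :
    ι K v * ctr (B v) ω = 0 := by
  obtain ⟨y0, hy0⟩ : ∃ y, B v y ≠ 0 := by
    by_contra! hc
    exact hv (hB.1 v hc)
  obtain ⟨y, hy⟩ : ∃ y, B v y = 1 := ⟨(B v y0)⁻¹ • y0, by simp [hy0]⟩
  let P : V →ₗ[K] V := LinearMap.id - (B v).smulRight y
  have hP : ∀ x, P x = x - B v x • y := fun x => by simp [P]
  let P' : V →ₗ[K] perpV B v := P.codRestrict _ (fun x => by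
    simp [perpV, hP, hy])
  let π : V →ₗ[K] Qt B v := (projQ B v) ∘ₗ P'
  have hπ : ExtendsProj B v π := by
    intro x
    have : P' x.1 = x := by
      apply Subtype.ext
      have hx : B v x.1 = 0 := x.2
      change P x.1 = x.1
      simp [hP, hx]
    simp [π, this]
  obtain ⟨s, hs⟩ := (projQ B v).exists_rightInverse_of_surjective
    (LinearMap.range_eq_top.mpr (Submodule.mkQ_surjective _))
  have h1 := h π hπ
  have h2 : ExteriorAlgebra.map π (ctr (B v) ω) = 0 := h1
  let g : V →ₗ[K] V := ((perpV B v).subtype ∘ₗ s) ∘ₗ π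
  have h3 : ExteriorAlgebra.map g (ctr (B v) ω) = 0 := by
    have : ExteriorAlgebra.map g
        = (ExteriorAlgebra.map ((perpV B v).subtype ∘ₗ s)).comp (ExteriorAlgebra.map π) := by
      rw [ExteriorAlgebra.map_comp_map]
    rw [this, AlgHom.comp_apply, h2, map_zero]
  have h4 := map_mod v g P (by
    intro x
    have : (projQ B v) (s (π x) - P' x) = 0 := by
      have := LinearMap.congr_fun hs (π x)
      rw [map_sub]
      simp only [LinearMap.comp_apply, LinearMap.id_apply] at this
      rw [this]; simp [π]
    have h5 : s (π x) - P' x ∈ lineIn B v := by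
      exact (Submodule.Quotient.mk_eq_zero _).mp this
    obtain ⟨c, hc⟩ := Submodule.mem_span_singleton.mp h5
    refine ⟨c, ?_⟩
    rw [hc]
    change (s (π x) : V) = P x + ((s (π x) : V) - P x)
    abel) (ctr (B v) ω)
  rw [h3, map_shear (B v) y P hP, ctr_self] at h4
  simpa [eq_comm] using h4

lemma maxIso_mem (B : LinearMap.BilinForm K V) (hsymm : B.IsSymm) (W : Submodule K V)
    (hW : MaxIsotropic B W) (v : V) (hvv : B v v = 0) (hv : ∀ w ∈ W, B w v = 0) : v ∈ W := by
  have hs : ∀ x y, B x y = B y x := fun x y => (hsymm.eq x y).symm ▸ rfl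
  have := hW.2 (W ⊔ Submodule.span K {v}) (by
    intro x hx y hy
    obtain ⟨a, ha, b, hb, rfl⟩ := Submodule.mem_sup.mp hx
    obtain ⟨c, hc, d, hd, rfl⟩ := Submodule.mem_sup.mp hy
    obtain ⟨s, rfl⟩ := Submodule.mem_span_singleton.mp hb
    obtain ⟨t, rfl⟩ := Submodule.mem_span_singleton.mp hd
    simp [hW.1 a ha c hc, hv a ha, hs v c, hv c hc, hvv]) le_sup_left
  rw [← this]
  exact Submodule.mem_sup_right (Submodule.mem_span_singleton_self v)

lemma maxIso_finrank [FiniteDimensional K V] (B : LinearMap.BilinForm K V) (hsymm : B.IsSymm)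
    (hB : B.Nondegenerate) (hWitt : MaxWittIndex B) (W : Submodule K V)
    (hW : MaxIsotropic B W) : Module.finrank K W = Module.finrank K V / 2 := by
  have hr : B.IsRefl := hsymm.isRefl
  apply le_antisymm
  · have h1 : W ≤ B.orthogonal W := fun x hx y hy => hW.1 y hy x hx
    have h2 := Submodule.finrank_mono h1
    have h3 := LinearMap.BilinForm.finrank_orthogonal hB W
    have := Submodule.finrank_le W
    omega
  · obtain ⟨M, hM, hMd⟩ := hWitt
    rw [← hMd]
    by_contra! hlt
    have h1 : B.orthogonal W ⊔ M ≤ B.orthogonal (W ⊓ M) := by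
      refine sup_le (LinearMap.BilinForm.orthogonal_le inf_le_left) ?_
      intro x hx y hy
      exact hM y hy.2 x hx
    have h2 := Submodule.finrank_mono h1
    rw [LinearMap.BilinForm.finrank_orthogonal hB] at h2
    have h3 := LinearMap.BilinForm.finrank_orthogonal hB W
    have h4 := Submodule.finrank_sup_add_finrank_inf_eq (B.orthogonal W) M
    have h5 := Submodule.finrank_le (W ⊓ M)
    have h5' := Submodule.finrank_le W
    have h6 : B.orthogonal W ⊓ M ≤ W ⊓ M := by
      intro x hx
      exact ⟨maxIso_mem B hsymm W hW x (hM x hx.2 x hx.2) (fun w hw => hx.1 w hw), hx.2⟩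
    have h7 := Submodule.finrank_mono h6
    omega

lemma span_top (X : Submodule K V) (m : ℕ) (b : Module.Basis (Fin m) K X) :
    Submodule.span K {ιMulti K m (fun i => (b i : V))} = epowSub K X m := by
  apply le_antisymm
  · rw [Submodule.span_singleton_le_iff_mem]
    exact Submodule.subset_span ⟨_, fun i => (b i).2, rfl⟩
  · apply Submodule.span_le.mpr
    rintro _ ⟨w, hw, rfl⟩
    have : (ιMulti K m).compLinearMap X.subtype
        = (LinearMap.toSpanSingleton K _ (ιMulti K m (fun i => (b i : V)))).compAlternatingMap
          b.det := by
      refine Module.Basis.ext_alternating b fun i h => ?_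
      let σ : Equiv.Perm (Fin m) := Equiv.ofBijective i (Finite.injective_iff_bijective.1 h)
      change (ιMulti K m).compLinearMap X.subtype (b ∘ σ) = (LinearMap.toSpanSingleton K _ (ιMulti K m (fun i => (b i : V)))).compAlternatingMap
          b.det (b ∘ σ)
      rw [AlternatingMap.map_perm, AlternatingMap.map_perm]
      congr 1
      simp [Module.Basis.det_self]
    have h := congrArg (fun F => F (fun i => (⟨w i, hw i⟩ : X))) this
    refine Submodule.mem_span_singleton.mpr ⟨b.det (fun i => (⟨w i, hw i⟩ : X)), ?_⟩
    exact h.symm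

lemma core (h2 : (2 : K) ≠ 0) (B : LinearMap.BilinForm K V) (hsymm : B.IsSymm)
    (e f : V) (hee : B e e = 0) (hff : B f f = 0) (hef : B e f = 1) (ω : ExteriorAlgebra K V)
    (he : ι K e * ctr (B e) ω = 0) (hf : ι K f * ctr (B f) ω = 0)
    (U : Submodule K V) (hUe : ∀ u ∈ U, B e u = 0) (hUf : ∀ u ∈ U, B f u = 0)
    (hu : ∀ u ∈ U, ι K u * ctr (B e) ω + ι K e * ctr (B u) ω = 0)
    (hu' : ∀ u ∈ U, ι K u * ctr (B f) ω + ι K f * ctr (B u) ω = 0) :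
    ∃ ω3 ω0 : ExteriorAlgebra K V, ω3 = ctr (B e) (ctr (B f) ω) ∧
      ω = ω0 + ι K e * (ι K f * ω3) ∧ ctr (B e) ω0 = 0 ∧
      ctr (B f) ω0 = 0 ∧ ∀ u ∈ U, ctr (B u) ω0 = 0 ∧ ι K u * ω3 = 0 := by
  have hs : ∀ x y, B x y = B y x := fun x y => (hsymm.eq x y).symm ▸ rfl
  have hfe : B f e = 1 := by rw [hs, hef]
  obtain ⟨ω3, h3⟩ : ∃ ω3, ω3 = ctr (B e) (ctr (B f) ω) := ⟨_, rfl⟩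
  have e3 : ctr (B e) ω3 = 0 := by rw [h3, ctr_self]
  have f3 : ctr (B f) ω3 = 0 := by rw [h3, ctr_comm, ctr_self, map_zero, neg_zero]
  have ie : ctr (B e) ω = - (ι K e * ω3) := by
    have := ctr_mul (B f) e (ctr (B e) ω)
    rw [he, map_zero, hfe, one_smul, ctr_comm, ← h3] at this
    rw [← sub_eq_zero, this]; simp
  have jf : ctr (B f) ω = ι K f * ω3 := by
    have := ctr_mul (B e) f (ctr (B f) ω)
    rw [hf, map_zero, hef, one_smul, ← h3] at this
    rw [← sub_eq_zero, this]
  obtain ⟨ω0, h0⟩ : ∃ ω0, ω0 = ω - ι K e * (ι K f * ω3) := ⟨_, rfl⟩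
  have e0 : ctr (B e) ω0 = 0 := by
    rw [h0, map_sub, ie, ctr_mul, ctr_mul, hee, hef, e3]; simp
  have f0 : ctr (B f) ω0 = 0 := by
    rw [h0, map_sub, jf, ctr_mul, ctr_mul, hff, hfe, f3]; simp
  have hω : ω = ω0 + ι K e * (ι K f * ω3) := by rw [h0]; abel
  refine ⟨ω3, ω0, h3, hω, e0, f0, fun u hU => ?_⟩
  have hue : B u e = 0 := by rw [hs, hUe u hU]
  have huf : B u f = 0 := by rw [hs, hUf u hU]
  have iu : ctr (B u) ω = ctr (B u) ω0 + ι K e * (ι K f * ctr (B u) ω3) := by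
    rw [hω, map_add, ctr_mul, ctr_mul, hue, huf]; simp
  have A1 : ctr (B u) ω0 + ι K u * ω3 = 0 := by
    have q : ι K e * (ctr (B u) ω0 + ι K u * ω3) = 0 := by
      have := hu u hU
      rw [ie, iu, mul_add, sq0, add_zero, mul_neg, anti u e, neg_neg] at this
      rw [mul_add, add_comm]; exact this
    have r := ctr_mul (B f) e (ctr (B u) ω0 + ι K u * ω3)
    rw [q, map_zero, map_add, ctr_comm (B f), f0, ctr_mul, hUf u hU, f3, hfe] at r
    simpa [eq_comm] using r
  have A2 : ctr (B u) ω0 - ι K u * ω3 = 0 := by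
    have q : ι K f * (ctr (B u) ω0 - ι K u * ω3) = 0 := by
      have := hu' u hU
      rw [jf, iu, mul_add, anti e f, mul_neg, sq0, neg_zero, add_zero, anti u f] at this
      rw [mul_sub, ← this]; abel
    have r := ctr_mul (B e) f (ctr (B u) ω0 - ι K u * ω3)
    rw [q, map_zero, map_sub, ctr_comm (B e), e0, ctr_mul, hUe u hU, e3, hef] at r
    simpa [eq_comm] using r
  have A3 : (2 : K) • (ι K u * ω3) = 0 := by
    rw [two_smul]
    calc _ = (ctr (B u) ω0 + ι K u * ω3) - (ctr (B u) ω0 - ι K u * ω3) := by abel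
      _ = 0 := by rw [A1, A2, sub_zero]
  have A4 : ι K u * ω3 = 0 := (smul_eq_zero.mp A3).resolve_left h2
  exact ⟨by rw [A4, add_zero] at A1; exact A1, A4⟩

lemma polar (B : LinearMap.BilinForm K V) (ω : ExteriorAlgebra K V) (x y : V)
    (hx : ι K x * ctr (B x) ω = 0) (hy : ι K y * ctr (B y) ω = 0)
    (hxy : ι K (x + y) * ctr (B (x + y)) ω = 0) :
    ι K x * ctr (B y) ω + ι K y * ctr (B x) ω = 0 := by
  rw [map_add, map_add, ctr_add_left, add_mul, mul_add, mul_add, hx, hy] at hxy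
  simpa using hxy

end Helpers

/-- Let `p = ⌊dim V/2⌋ ≥ 2` be the (maximal) Witt index, `p < k < dim V`,
and `W, W'` maximal isotropic with `dim (W ∩ W') = p - 1`. If `ω ∈ Λ^k V` is nonzero and
`Φ_v(ω) = 0` for every (nonzero) isotropic `(v ∈ W ∨ v ∈ W')`, then `ω = α ∧ ω'` where `α`
generates the one-dimensional space `Λ^{p+1}(W + W')` and `ω' ∈ Λ^{k-p-1} V`. -/
theorem eq_alpha_wedge_of_Phi_eq_zero (K V : Type) [Field K] [AddCommGroup V] [Module K V]
    [FiniteDimensional K V] (h2 : (2 : K) ≠ 0)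
    (B : LinearMap.BilinForm K V) (hsymm : B.IsSymm) (hB : B.Nondegenerate)
    (hWitt : MaxWittIndex B)
    (hp : 2 ≤ Module.finrank K V / 2)
    (W W' : Submodule K V) (hW : MaxIsotropic B W) (hW' : MaxIsotropic B W')
    (hWW' : Module.finrank K ↥(W ⊓ W') = Module.finrank K V / 2 - 1)
    (k : ℕ) (hk : Module.finrank K V / 2 < k) (hkd : k < Module.finrank K V)
    (ω : ExteriorAlgebra K V) (hω : ω ∈ ⋀[K]^k V) (hω0 : ω ≠ 0)
    (h : ∀ v : V, v ≠ 0 → (v ∈ W ∨ v ∈ W') → B v v = 0 →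
      ∀ π : V →ₗ[K] Qt B v, ExtendsProj B v π → Phi B v π ω = 0) :
    ∃ α : ExteriorAlgebra K V,
      α ∈ epowSub K (W ⊔ W') (Module.finrank K V / 2 + 1) ∧
      Submodule.span K {α} = epowSub K (W ⊔ W') (Module.finrank K V / 2 + 1) ∧
      ∃ ω' ∈ ⋀[K]^(k - (Module.finrank K V / 2) - 1) V, ω = α * ω' := by
  have hs : ∀ x y, B x y = B y x := fun x y => (hsymm.eq x y).symm ▸ rfl
  have dW := maxIso_finrank B hsymm hB hWitt W hW
  have dW' := maxIso_finrank B hsymm hB hWitt W' hW'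
  have dX : Module.finrank K ↥(W ⊔ W') = Module.finrank K V / 2 + 1 := by
    have := Submodule.finrank_sup_add_finrank_inf_eq W W'
    omega
  generalize hpp : Module.finrank K V / 2 = p at *
  -- pointwise conditions
  have hc : ∀ v : V, (v ∈ W ∨ v ∈ W') → ι K v * ctr (B v) ω = 0 := by
    intro v hv
    by_cases h0 : v = 0
    · simp [h0]
    have hvv : B v v = 0 := hv.elim (fun q => hW.1 v q v q) (fun q => hW'.1 v q v q)
    exact phi_zero B hB v h0 hvv ω (h v h0 hv hvv)
  have hpolW : ∀ x ∈ W, ∀ y ∈ W, ι K x * ctr (B y) ω + ι K y * ctr (B x) ω = 0 :=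
    fun x hx y hy => polar B ω x y (hc _ (.inl hx)) (hc _ (.inl hy)) (hc _ (.inl (add_mem hx hy)))
  have hpolW' : ∀ x ∈ W', ∀ y ∈ W', ι K x * ctr (B y) ω + ι K y * ctr (B x) ω = 0 :=
    fun x hx y hy => polar B ω x y (hc _ (.inr hx)) (hc _ (.inr hy)) (hc _ (.inr (add_mem hx hy)))
  -- choice of e and f
  obtain ⟨e, heW, heW'⟩ : ∃ e ∈ W, e ∉ W' := by
    by_contra! hcon
    have : W ⊓ W' = W := inf_eq_left.mpr hcon
    rw [this] at hWW'
    omega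
  obtain ⟨f0, hf0W', hf0W⟩ : ∃ f ∈ W', f ∉ W := by
    by_contra! hcon
    have : W ⊓ W' = W' := inf_eq_right.mpr hcon
    rw [this] at hWW'
    omega
  have decomp : ∀ (Y Z : Submodule K V) (y : V), y ∈ Y → y ∉ Z →
      Module.finrank K Y = Module.finrank K ↥(Y ⊓ Z) + 1 → Y ≤ (Y ⊓ Z) ⊔ Submodule.span K {y} := by
    intro Y Z y hy hz hd
    have hlt : Y ⊓ Z < (Y ⊓ Z) ⊔ Submodule.span K {y} := by
      refine lt_of_le_of_ne le_sup_left fun heq => hz ?_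
      have : y ∈ (Y ⊓ Z) ⊔ Submodule.span K {y} :=
        Submodule.mem_sup_right (Submodule.mem_span_singleton_self y)
      rw [← heq] at this
      exact this.2
    have h1 := Submodule.finrank_lt_finrank_of_lt hlt
    have hle : (Y ⊓ Z) ⊔ Submodule.span K {y} ≤ Y :=
      sup_le inf_le_left ((Submodule.span_singleton_le_iff_mem _ _).mpr hy)
    exact (Submodule.eq_of_le_of_finrank_le hle (by omega)).ge
  have decW : W ≤ (W ⊓ W') ⊔ Submodule.span K {e} := decomp W W' e heW heW' (by omega)
  have hef0 : B e f0 ≠ 0 := by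
    intro h0
    refine hf0W (maxIso_mem B hsymm W hW f0 (hW'.1 _ hf0W' _ hf0W') fun w hw => ?_)
    obtain ⟨u, hu, z, hz, rfl⟩ := Submodule.mem_sup.mp (decW hw)
    obtain ⟨c, rfl⟩ := Submodule.mem_span_singleton.mp hz
    simp [h0, hW'.1 u hu.2 f0 hf0W']
  obtain ⟨f, hfW', hfW, hef⟩ : ∃ f ∈ W', f ∉ W ∧ B e f = 1 := by
    refine ⟨(B e f0)⁻¹ • f0, W'.smul_mem _ hf0W', fun hh => hf0W ?_, by simp [hef0]⟩
    exact (W.smul_mem_iff (inv_ne_zero hef0)).mp hh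
  have decW' : W' ≤ (W ⊓ W') ⊔ Submodule.span K {f} := by
    have := decomp W' W f hfW' hfW (by rw [inf_comm]; omega)
    rwa [inf_comm] at this
  obtain ⟨ω3, ω0, h3, hω3, e0, f0', hU⟩ := core h2 B hsymm e f (hW.1 _ heW _ heW)
    (hW'.1 _ hfW' _ hfW') hef ω (hc e (.inl heW)) (hc f (.inr hfW')) (W ⊓ W')
    (fun u hu => hW.1 _ heW _ hu.1) (fun u hu => hW'.1 _ hfW' _ hu.2)
    (fun u hu => hpolW u hu.1 e heW) (fun u hu => hpolW' u hu.2 f hfW')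
  -- basis and dual families
  let b : Module.Basis (Fin (p + 1)) K ↥(W ⊔ W') := Module.finBasisOfFinrankEq K _ dX
  choose φ hφ using fun i => LinearMap.exists_extend (b.coord i)
  have hφb : ∀ i j, φ i (b j : V) = if i = j then 1 else 0 := by
    intro i j
    have := LinearMap.congr_fun (hφ i) (b j)
    simp only [LinearMap.comp_apply, Submodule.subtype_apply] at this
    rw [this]
    simp [Finsupp.single_apply, eq_comm]
  -- induction principle on W ⊔ W'
  have hX : ∀ (S : Submodule K V), W ⊓ W' ≤ S → e ∈ S → f ∈ S → W ⊔ W' ≤ S := by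
    intro S h1 h2 h3
    exact sup_le (decW.trans (sup_le h1 ((Submodule.span_singleton_le_iff_mem _ _).mpr h2)))
      (decW'.trans (sup_le h1 ((Submodule.span_singleton_le_iff_mem _ _).mpr h3)))
  have z0 : ω0 = 0 := by
    obtain ⟨k', rfl⟩ : ∃ k', k = k' + 1 + 1 := ⟨k - 2, by omega⟩
    have m3 : ω3 ∈ ⋀[K]^k' V := by
      rw [h3]; exact ctr_mem _ _ _ (ctr_mem _ _ _ hω)
    have m0 : ω0 ∈ ⋀[K]^(k' + 1 + 1) V := by
      have : ω0 = ω - ι K e * (ι K f * ω3) := by rw [hω3]; abel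
      rw [this]
      refine sub_mem hω ?_
      rw [exteriorPower, pow_succ', pow_succ']
      exact Submodule.mul_mem_mul ⟨e, rfl⟩ (Submodule.mul_mem_mul ⟨f, rfl⟩ m3)
    refine vanish (p + 1) (k' + 1 + 1) (fun j => (B.toDual hB).symm (φ j)) (fun i => B (b i : V))
      ?_ ω0 m0 (by omega) ?_
    · intro i j
      rw [hs, LinearMap.BilinForm.apply_toDual_symm_apply, hφb]
      simp [eq_comm]
    · intro i
      let S : Submodule K V :=
        { carrier := {x | ctr (B x) ω0 = 0}
          zero_mem' := by simp [ctr]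
          add_mem' := by
            intro x y hx hy
            simp only [Set.mem_setOf_eq] at *
            rw [map_add, ctr_add_left, hx, hy, add_zero]
          smul_mem' := by
            intro c x hx
            simp only [Set.mem_setOf_eq] at *
            rw [map_smul, ctr_smul_left, hx, smul_zero] }
      exact hX S (fun u hu => (hU u hu).1) e0 f0' (b i).2
  rw [z0, zero_add] at hω3
  refine ⟨ιMulti K (p + 1) (fun i => (b i : V)), Submodule.subset_span ⟨_, fun i => (b i).2, rfl⟩,
    span_top _ _ b, ?_⟩
  refine divide (p + 1) (fun i => (b i : V)) φ hφb (k - p - 1) ω ?_ ?_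
  · have : k - p - 1 + (p + 1) = k := by omega
    rw [this]; exact hω
  · intro i
    let S : Submodule K V :=
      { carrier := {x | ι K x * ω = 0}
        zero_mem' := by simp
        add_mem' := by
          intro x y hx hy
          simp only [Set.mem_setOf_eq] at *
          rw [map_add, add_mul, hx, hy, add_zero]
        smul_mem' := by
          intro c x hx
          simp only [Set.mem_setOf_eq] at *
          rw [map_smul, smul_mul_assoc, hx, smul_zero] }
    refine hX S (fun u hu => ?_) ?_ ?_ (b i).2
    · change ι K u * ω = 0
      rw [hω3, anti, anti u f, (hU u hu).2]; simp
    · change ι K e * ω = 0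
      rw [hω3, sq0]
    · change ι K f * ω = 0
      rw [hω3, anti, sq0]; simp
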